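/- arXiv:2307.11915 — 4 statements merged into one kernel-verified Lean document; each statement's English description precedes it below -/
import Mathlib

section
/- Let d ≥ 1 and n be integers and let η ⊆ {1,…,n} be a subset with d ≤ |η| ≤ n−1. Then the convex hull in ℝⁿ of the indicator vectors 1_λ, taken over all d-element subsets λ ⊆ {1,…,n} with |λ ∩ η| ≥ d−1, equals the set {x ∈ ℝⁿ : 0 ≤ x_i ≤ 1 for all i, x_1 + ⋯ + x_n = d, and Σ_{i ∈ {1,…,n}∖η} x_i ≤ 1}. -/
open Set

/-- The indices of the coordinates of `x` lying strictly between `0` and `1`. -/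
noncomputable def fractionalCoords {ι : Type*} [Fintype ι] (x : ι → ℝ) : Finset ι :=
  {i | 0 < x i ∧ x i < 1}

/-- Sums of `0`/`1` values count the ones. -/
theorem sum_eq_card_filter_eq_one {ι : Type*} {x : ι → ℝ} (s : Finset ι)
    (hx : ∀ i ∈ s, x i = 0 ∨ x i = 1) :
    ∑ i ∈ s, x i = ((s.filter (fun i => x i = 1)).card : ℝ) := by
  rw [Finset.card_filter, Nat.cast_sum]
  refine Finset.sum_congr rfl fun i hi => ?_
  rcases hx i hi with h | h <;> simp [h]

/-- Move the weight `c` from coordinate `j` of `x` to coordinate `i`. -/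
noncomputable def transfer {ι : Type*} [DecidableEq ι] (x : ι → ℝ) (i j : ι) (c : ℝ) : ι → ℝ :=
  x + c • (Pi.single i 1 - Pi.single j 1)

theorem sum_transfer {ι : Type*} [DecidableEq ι] (x : ι → ℝ) (c : ℝ) (i j : ι)
    (s : Finset ι) :
    ∑ k ∈ s, transfer x i j c k =
      ∑ k ∈ s, x k + c * ((if i ∈ s then 1 else 0) - (if j ∈ s then 1 else 0)) := by
  simp only [transfer, Pi.add_apply, Pi.smul_apply, Pi.sub_apply, smul_eq_mul,
    Finset.sum_add_distrib, ← Finset.mul_sum, Finset.sum_sub_distrib, Pi.single_apply,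
    Finset.sum_ite_eq']

section

variable {ι : Type*} [Fintype ι]

theorem mem_fractionalCoords {x : ι → ℝ} {i : ι} :
    i ∈ fractionalCoords x ↔ 0 < x i ∧ x i < 1 := by
  simp [fractionalCoords]

theorem eq_zero_or_eq_one_of_notMem_fractionalCoords {x : ι → ℝ} {i : ι}
    (hx : 0 ≤ x i ∧ x i ≤ 1) (hi : i ∉ fractionalCoords x) : x i = 0 ∨ x i = 1 := by
  rw [mem_fractionalCoords, not_and_or, not_lt, not_lt] at hi
  exact hi.imp (fun h => le_antisymm h hx.1) (fun h => le_antisymm hx.2 h)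

/-- A fractional coordinate of a point with integral coordinate sum is not the only one. -/
theorem exists_ne_mem_fractionalCoords {x : ι → ℝ} (hx : ∀ i, 0 ≤ x i ∧ x i ≤ 1) {d : ℕ}
    (hsum : ∑ i, x i = d) {i : ι} (hi : i ∈ fractionalCoords x) :
    ∃ j ∈ fractionalCoords x, j ≠ i := by
  classical
  by_contra! h
  have hs := sum_eq_card_filter_eq_one (x := x) (Finset.univ.erase i) fun j hj =>
    eq_zero_or_eq_one_of_notMem_fractionalCoords (hx j) fun hj' =>
      Finset.ne_of_mem_erase hj (h j hj')
  rw [← Finset.add_sum_erase _ _ (Finset.mem_univ i), hs] at hsum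
  obtain ⟨h0, h1⟩ := mem_fractionalCoords.1 hi
  set m := ((Finset.univ.erase i).filter (fun j => x j = 1)).card
  have h2 : m < d := by exact_mod_cast (by linarith : (m : ℝ) < d)
  have h3 : d < m + 1 := by exact_mod_cast (by linarith : (d : ℝ) < m + 1)
  omega

/-- Shifting weight from the fractional coordinate `j` to the fractional coordinate `i` until one
of them becomes integral. -/
theorem exists_shift_fractionalCoords_ssubset [DecidableEq ι] {x : ι → ℝ}
    (hx : ∀ i, 0 ≤ x i ∧ x i ≤ 1) {i j : ι} (hij : i ≠ j)
    (hi : i ∈ fractionalCoords x) (hj : j ∈ fractionalCoords x) :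
    ∃ s : ℝ, 0 < s ∧ (∀ k, 0 ≤ transfer x i j s k ∧
        transfer x i j s k ≤ 1) ∧
      fractionalCoords (transfer x i j s) ⊂ fractionalCoords x := by
  obtain ⟨hi0, hi1⟩ := mem_fractionalCoords.1 hi
  obtain ⟨hj0, hj1⟩ := mem_fractionalCoords.1 hj
  set s := min (1 - x i) (x j) with hs
  have hs0 : 0 < s := lt_min (by linarith) hj0
  have hsi : s ≤ 1 - x i := min_le_left _ _
  have hsj : s ≤ x j := min_le_right _ _
  have hyi : transfer x i j s i = x i + s := by simp [transfer, hij]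
  have hyj : transfer x i j s j = x j - s := by simp [transfer, hij.symm, sub_eq_add_neg]
  have hyk : ∀ k, k ≠ i → k ≠ j → transfer x i j s k = x k := fun k h h' => by
    simp [transfer, h, h']
  refine ⟨s, hs0, fun k => ?_, Finset.ssubset_iff_subset_ne.2 ⟨fun k hk => ?_, fun h => ?_⟩⟩
  · by_cases h : k = i
    · subst h; rw [hyi]; constructor <;> linarith
    by_cases h' : k = j
    · subst h'; rw [hyj]; constructor <;> linarith
    rw [hyk k h h']; exact hx k
  · by_cases h : k = i
    · rwa [h]
    by_cases h' : k = j
    · rwa [h']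
    rwa [mem_fractionalCoords, hyk k h h', ← mem_fractionalCoords] at hk
  · rw [← h, mem_fractionalCoords, hyi] at hi
    rw [← h, mem_fractionalCoords, hyj] at hj
    rcases min_choice (1 - x i) (x j) with h' | h' <;> rw [← hs] at h' <;> linarith [hi.2, hj.1]

/-- If every shift along `i`, `j` inside the unit cube stays in `P`, then membership of `x` in a
convex set follows from that of points of `P` with fewer fractional coordinates. -/
theorem mem_of_shifts_mem [DecidableEq ι] {x : ι → ℝ} {C P : Set (ι → ℝ)} (hC : Convex ℝ C)
    (hx : ∀ i, 0 ≤ x i ∧ x i ≤ 1) {i j : ι} (hij : i ≠ j)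
    (hi : i ∈ fractionalCoords x) (hj : j ∈ fractionalCoords x)
    (hP : ∀ s : ℝ, (∀ k, 0 ≤ transfer x i j s k ∧
        transfer x i j s k ≤ 1) →
      transfer x i j s ∈ P)
    (ih : ∀ y ∈ P, (fractionalCoords y).card < (fractionalCoords x).card → y ∈ C) : x ∈ C := by
  obtain ⟨s, hs, hs1, hs2⟩ := exists_shift_fractionalCoords_ssubset hx hij hi hj
  obtain ⟨t, ht, ht1, ht2⟩ := exists_shift_fractionalCoords_ssubset hx hij.symm hj hi
  have hneg : transfer x j i t = transfer x i j (-t) := by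
    rw [transfer, transfer, neg_smul, ← smul_neg, neg_sub]
  rw [hneg] at ht1 ht2
  have h1 := ih _ (hP s hs1) (Finset.card_lt_card hs2)
  have h2 := ih _ (hP (-t) ht1) (Finset.card_lt_card ht2)
  have hst : 0 < s + t := by positivity
  have := hC h1 h2 (div_nonneg ht.le hst.le) (div_nonneg hs.le hst.le)
    (by field_simp; ring)
  convert this using 1
  ext k
  simp only [transfer, Pi.add_apply, Pi.smul_apply, smul_eq_mul]
  field_simp
  ring

/-- If `j` is the only fractional coordinate in `s` and the coordinates in `s` sum to at most `1`,
then the other coordinates in `s` vanish. -/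
theorem sum_eq_of_unique_fractionalCoord {x : ι → ℝ} (hx : ∀ i, 0 ≤ x i ∧ x i ≤ 1)
    {s : Finset ι} (hsum : ∑ k ∈ s, x k ≤ 1) {j : ι} (hjs : j ∈ s)
    (hj : j ∈ fractionalCoords x) (huniq : ∀ k ∈ s, k ∈ fractionalCoords x → k = j) :
    ∑ k ∈ s, x k = x j := by
  classical
  refine Finset.sum_eq_single_of_mem j hjs fun k hk hkj => ?_
  refine (eq_zero_or_eq_one_of_notMem_fractionalCoords (hx k)
    fun h => hkj (huniq k hk h)).resolve_right fun h => ?_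
  have h1 : ∑ l ∈ {k, j}, x l ≤ ∑ l ∈ s, x l :=
    Finset.sum_le_sum_of_subset_of_nonneg (by simp [Finset.insert_subset_iff, hk, hjs])
      fun l _ _ => (hx l).1
  rw [Finset.sum_pair hkj, h] at h1
  linarith [(mem_fractionalCoords.1 hj).1]

/-- The slice of the unit cube cut out by `∑ x i = d` and `∑ i ∈ s, x i ≤ 1` is contained in every
convex set containing its `0`/`1` points. -/
theorem mem_convex_of_zero_one_points_mem {C : Set (ι → ℝ)} (hC : Convex ℝ C) {d : ℕ}
    {s : Finset ι}
    (hvert : ∀ x : ι → ℝ, (∀ i, x i = 0 ∨ x i = 1) → ∑ i, x i = d → ∑ i ∈ s, x i ≤ 1 → x ∈ C)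
    (x : ι → ℝ) (hx : ∀ i, 0 ≤ x i ∧ x i ≤ 1) (hsum : ∑ i, x i = d)
    (hs : ∑ i ∈ s, x i ≤ 1) : x ∈ C := by
  classical
  induction hm : (fractionalCoords x).card using Nat.strong_induction_on generalizing x with
  | _ m ih =>
  subst hm
  have descend : ∀ i ∈ fractionalCoords x, ∀ j ∈ fractionalCoords x, i ≠ j →
      (∀ c : ℝ, (∀ k, 0 ≤ transfer x i j c k ∧
        transfer x i j c k ≤ 1) →
        ∑ k ∈ s, transfer x i j c k ≤ 1) → x ∈ C := by
    intro i hi j hj hij h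
    refine mem_of_shifts_mem (P := {y | (∀ i, 0 ≤ y i ∧ y i ≤ 1) ∧ ∑ i, y i = d ∧
      ∑ i ∈ s, y i ≤ 1}) hC hx hij hi hj (fun c hc => ⟨hc, ?_, h c hc⟩)
      fun y hy hlt => ih _ hlt y hy.1 hy.2.1 hy.2.2 rfl
    rw [sum_transfer, hsum]
    simp
  by_cases hfrac : ∃ i, i ∈ fractionalCoords x
  swap
  · exact hvert x (fun i => eq_zero_or_eq_one_of_notMem_fractionalCoords (hx i)
      fun hi => hfrac ⟨i, hi⟩) hsum hs
  by_cases hsame : ∃ i ∈ fractionalCoords x, ∃ j ∈ fractionalCoords x, i ≠ j ∧ (i ∈ s ↔ j ∈ s)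
  · obtain ⟨i, hi, j, hj, hij, hside⟩ := hsame
    refine descend i hi j hj hij fun c _ => ?_
    rw [sum_transfer]
    simpa [hside] using hs
  · have hdiff : ∃ i ∈ fractionalCoords x, ∃ j ∈ fractionalCoords x, i ∉ s ∧ j ∈ s := by
      obtain ⟨i, hi⟩ := hfrac
      obtain ⟨j, hj, hji⟩ := exists_ne_mem_fractionalCoords hx hsum hi
      by_cases his : i ∈ s
      · exact ⟨j, hj, i, hi, fun hjs => hsame ⟨j, hj, i, hi, hji, by simp [his, hjs]⟩, his⟩
      · exact ⟨i, hi, j, hj, his,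
          by_contra fun hjs => hsame ⟨j, hj, i, hi, hji, by simp [his, hjs]⟩⟩
    obtain ⟨i, hi, j, hj, his, hjs⟩ := hdiff
    have hij : i ≠ j := fun h => his (h ▸ hjs)
    refine descend i hi j hj hij fun c hc => ?_
    have h := sum_eq_of_unique_fractionalCoord hx hs hjs hj fun k hks hk =>
      by_contra fun hkj => hsame ⟨k, hk, j, hj, hkj, by simp [hks, hjs]⟩
    have hcj := (hc j).2
    rw [sum_transfer, h]
    simpa [transfer, his, hjs, hij.symm] using hcj

end

/-- For `1 ≤ d` and `η ⊆ {1,…,n}` with `d ≤ |η| ≤ n - 1`, the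
convex hull of the indicator vectors of the `d`-element subsets `λ` with
`|λ ∩ η| ≥ d - 1` equals the part of the hypersimplex where
`Σ_{i ∉ η} x_i ≤ 1` (the matroid polytope of `Leaf_η`). -/
theorem leaf_polytope (d n : ℕ) (hd : 1 ≤ d) (η : Finset (Fin n))
    (h1 : d ≤ η.card) (h2 : η.card ≤ n - 1) :
    convexHull ℝ {x : Fin n → ℝ |
        ∃ lam : Finset (Fin n), lam.card = d ∧ d - 1 ≤ (lam ∩ η).card ∧
          x = Set.indicator ↑lam 1} =
      {x : Fin n → ℝ |
        (∀ i, 0 ≤ x i ∧ x i ≤ 1) ∧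
        (∑ i, x i = (d : ℝ)) ∧
        ∑ i ∈ ηᶜ, x i ≤ 1} := by
  classical
  apply Set.Subset.antisymm
  · refine convexHull_min ?_ ?_
    · rintro x ⟨lam, hcard, hinter, rfl⟩
      refine ⟨fun i => ?_, ?_, ?_⟩
      · by_cases h : i ∈ lam <;> simp [h]
      · simp [Set.indicator_apply, hcard]
      · have h := Finset.card_inter_add_card_sdiff lam η
        have h' : ηᶜ ∩ lam = lam \ η := by ext; simp [and_comm]
        simp only [Set.indicator_apply, Finset.mem_coe, Pi.one_apply, Finset.sum_ite_mem, h',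
          Finset.sum_const, nsmul_eq_mul, mul_one]
        exact_mod_cast (by omega : (lam \ η).card ≤ 1)
    · rintro x ⟨hx, hxs, hxη⟩ y ⟨hy, hys, hyη⟩ a b ha hb hab
      simp only [Set.mem_ofPred_eq, Pi.add_apply, Pi.smul_apply, smul_eq_mul,
        Finset.sum_add_distrib, ← Finset.mul_sum, hxs, hys]
      refine ⟨fun i => ⟨?_, ?_⟩, ?_, ?_⟩
      · have := mul_nonneg ha (hx i).1
        have := mul_nonneg hb (hy i).1
        linarith
      · have := mul_le_mul_of_nonneg_left (hx i).2 ha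
        have := mul_le_mul_of_nonneg_left (hy i).2 hb
        linarith
      · rw [← add_mul, hab, one_mul]
      · have := mul_le_mul_of_nonneg_left hxη ha
        have := mul_le_mul_of_nonneg_left hyη hb
        linarith
  · rintro x ⟨hx, hsum, hη⟩
    refine mem_convex_of_zero_one_points_mem (convex_convexHull ℝ _) (fun y hy hys hyη =>
      subset_convexHull ℝ _ ?_) x hx hsum hη
    rw [sum_eq_card_filter_eq_one _ fun i _ => hy i, Nat.cast_inj] at hys
    rw [sum_eq_card_filter_eq_one _ fun i _ => hy i, Nat.cast_le_one] at hyη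
    refine ⟨Finset.univ.filter (fun i => y i = 1), hys, ?_, ?_⟩
    · have h := Finset.card_inter_add_card_sdiff (Finset.univ.filter (fun i => y i = 1)) η
      have h' : Finset.univ.filter (fun i => y i = 1) \ η = ηᶜ.filter (fun i => y i = 1) := by
        ext; simp [and_comm]
      rw [h'] at h
      omega
    · ext i
      rcases hy i with h | h <;> simp [h]
end

section
/- Consider the polynomials f = xy + x − 2y and g = y² − y + 1 in ℂ[x,y]. The set of common zeros of f and g in ℂ² is exactly {q₁, q₂}, where q₁ = ((3 − i√3)/3, (1 − i√3)/2) and q₂ = ((3 + i√3)/3, (1 + i√3)/2). Moreover, each of the following twenty polynomials is nonzero at both q₁ and q₂: x, y, x−1, x−2, y−1, y+1, x−y, x−2y, x−y−1, xy−y+1, xy−2y+1, x+y²−y, xy−2y+2, x+y²−2y, x+y²−y−1, xy−y²−y+1, xy²−y²+y−1, xy²−2y²+y−1, xy²−2y²+2y−1, x²y−xy²−2xy+x+2y². -/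
open Complex

/-- The point `q₁ = ((3 - i√3)/3, (1 - i√3)/2)`. -/
noncomputable def q₁ : ℂ × ℂ :=
  ((3 - I * Real.sqrt 3) / 3, (1 - I * Real.sqrt 3) / 2)

/-- The point `q₂ = ((3 + i√3)/3, (1 + i√3)/2)`. -/
noncomputable def q₂ : ℂ × ℂ :=
  ((3 + I * Real.sqrt 3) / 3, (1 + I * Real.sqrt 3) / 2)

/-- The twenty polynomials generating the semigroup `U` for `Q_sing`,
as functions of `(x, y) ∈ ℂ²`. -/
def semigroupGens : List (ℂ → ℂ → ℂ) :=
  [fun x _ => x,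
   fun _ y => y,
   fun x _ => x - 1,
   fun x _ => x - 2,
   fun _ y => y - 1,
   fun _ y => y + 1,
   fun x y => x - y,
   fun x y => x - 2 * y,
   fun x y => x - y - 1,
   fun x y => x * y - y + 1,
   fun x y => x * y - 2 * y + 1,
   fun x y => x + y ^ 2 - y,
   fun x y => x * y - 2 * y + 2,
   fun x y => x + y ^ 2 - 2 * y,
   fun x y => x + y ^ 2 - y - 1,
   fun x y => x * y - y ^ 2 - y + 1,
   fun x y => x * y ^ 2 - y ^ 2 + y - 1,
   fun x y => x * y ^ 2 - 2 * y ^ 2 + y - 1,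
   fun x y => x * y ^ 2 - 2 * y ^ 2 + 2 * y - 1,
   fun x y => x ^ 2 * y - x * y ^ 2 - 2 * x * y + x + 2 * y ^ 2]

theorem mem_commonZeros_iff {x y : ℂ} :
    x * y + x - 2 * y = 0 ∧ y ^ 2 - y + 1 = 0 ↔
      3 * x = 2 * (y + 1) ∧ y ^ 2 - y + 1 = 0 := by
  grind

theorem ofReal_sqrt_three_sq : (Real.sqrt 3 : ℂ) ^ 2 = 3 := by
  exact_mod_cast Real.sq_sqrt (show (0 : ℝ) ≤ 3 by norm_num)

theorem commonZeros_eq :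
    {p : ℂ × ℂ | p.1 * p.2 + p.1 - 2 * p.2 = 0 ∧ p.2 ^ 2 - p.2 + 1 = 0} = {q₁, q₂} := by
  have hs := ofReal_sqrt_three_sq
  have hI := I_sq
  ext ⟨x, y⟩
  simp only [Set.mem_ofPred_eq, Set.mem_insert_iff, Set.mem_singleton_iff, q₁, q₂, Prod.mk.injEq,
    mem_commonZeros_iff]
  constructor
  · rintro ⟨hx, hy⟩
    have hprod : (y - (1 - I * Real.sqrt 3) / 2) * (y - (1 + I * Real.sqrt 3) / 2) = 0 := by
      linear_combination hy - (Real.sqrt 3 : ℂ) ^ 2 / 4 * hI + hs / 4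
    rcases mul_eq_zero.mp hprod with h | h
    · left
      exact ⟨by linear_combination hx / 3 + 2 / 3 * h, sub_eq_zero.mp h⟩
    · right
      exact ⟨by linear_combination hx / 3 + 2 / 3 * h, sub_eq_zero.mp h⟩
  · rintro (⟨rfl, rfl⟩ | ⟨rfl, rfl⟩) <;>
    exact ⟨by ring, by linear_combination (Real.sqrt 3 : ℂ) ^ 2 / 4 * hI - hs / 4⟩

theorem semigroupGens_ne_zero {x y : ℂ} (hx : 3 * x = 2 * (y + 1)) (hy : y ^ 2 - y + 1 = 0) :
    ∀ f ∈ semigroupGens, f x y ≠ 0 := by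
  simp only [semigroupGens, List.forall_mem_cons, List.not_mem_nil, false_imp_iff, implies_true,
    and_true]
  refine ⟨?_, ?_, ?_, ?_, ?_, ?_, ?_, ?_, ?_, ?_, ?_, ?_, ?_, ?_, ?_, ?_, ?_, ?_, ?_, ?_⟩ <;>
    grind

/-- The common zeros in `ℂ²` of `xy + x - 2y` and `y² - y + 1`
are exactly `q₁` and `q₂`, and each of the twenty semigroup generators is nonzero
at both points. -/
theorem Qsing_singular_points :
    ({p : ℂ × ℂ | p.1 * p.2 + p.1 - 2 * p.2 = 0 ∧ p.2 ^ 2 - p.2 + 1 = 0}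
        = {q₁, q₂}) ∧
    (∀ q ∈ ({q₁, q₂} : Set (ℂ × ℂ)), ∀ f ∈ semigroupGens, f q.1 q.2 ≠ 0) := by
  refine ⟨commonZeros_eq, fun q hq => ?_⟩
  rw [← commonZeros_eq] at hq
  obtain ⟨hx, hy⟩ := mem_commonZeros_iff.mp hq
  exact semigroupGens_ne_zero hx hy
end

section
/- Let 𝓛 be the following collection of twelve subsets of {1,…,12}: {1,2,6,8}, {1,3,5,7}, {1,9,12}, {2,4,5,9}, {2,7,11}, {3,4,6}, {3,8,9}, {3,10,12}, {4,7,8}, {4,10,11}, {5,6,10}, {8,11,12}. Let N be the 3×12 matrix over ℚ with rows (1, 0, 0, 1, 1, 1, −4, 1, 1, 3, −4, 3), (0, 1, 0, 1, 0, 1, 0, −3, −3, −3, −6, −3), (0, 0, 1, 1, 1, 0, −3, 0, 1, 6, −3, 1). Then for every 3-element subset S ⊆ {1,…,12}, the columns of N indexed by S are linearly dependent over ℚ if and only if S is contained in some member of 𝓛. (Hence the matroid Q_sing with set of lines 𝓛 is realizable over ℚ, and in particular over ℂ.) -/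
/-- The twelve lines of the matroid `Q_sing`, as subsets of `{1,…,12} ⊆ ℕ`. -/
def singLines : Set (Set ℕ) :=
  {{1, 2, 6, 8}, {1, 3, 5, 7}, {1, 9, 12}, {2, 4, 5, 9}, {2, 7, 11}, {3, 4, 6},
   {3, 8, 9}, {3, 10, 12}, {4, 7, 8}, {4, 10, 11}, {5, 6, 10}, {8, 11, 12}}

/-- The `3 × 12` rational matrix realizing `Q_sing`; column `j` (for `j : Fin 12`)
corresponds to the ground set element `j + 1 ∈ {1,…,12}`. -/
def Nsing : Matrix (Fin 3) (Fin 12) ℚ :=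
  !![1, 0, 0, 1, 1, 1, -4, 1, 1, 3, -4, 3;
     0, 1, 0, 1, 0, 1, 0, -3, -3, -3, -6, -3;
     0, 0, 1, 1, 1, 0, -3, 0, 1, 6, -3, 1]

/-- The matrix `Nsing` with its entries read as integers. -/
def NsingInt : Matrix (Fin 3) (Fin 12) ℤ :=
  !![1, 0, 0, 1, 1, 1, -4, 1, 1, 3, -4, 3;
     0, 1, 0, 1, 0, 1, 0, -3, -3, -3, -6, -3;
     0, 0, 1, 1, 1, 0, -3, 0, 1, 6, -3, 1]

/-- The lines of `Q_sing` as finite sets. -/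
def singLinesFinset : Finset (Finset ℕ) :=
  {{1, 2, 6, 8}, {1, 3, 5, 7}, {1, 9, 12}, {2, 4, 5, 9}, {2, 7, 11}, {3, 4, 6},
   {3, 8, 9}, {3, 10, 12}, {4, 7, 8}, {4, 10, 11}, {5, 6, 10}, {8, 11, 12}}

theorem Nsing_eq_map_intCast : Nsing = NsingInt.map (Int.castRingHom ℚ) := by
  ext r j
  fin_cases r <;> fin_cases j <;> simp [Nsing, NsingInt]

/-- The `3 × 3` minor on columns `a`, `b`, `c` of a matrix with three rows. -/
theorem det_submatrix_three {R n : Type*} [CommRing R] (A : Matrix (Fin 3) n R) (a b c : n) :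
    (A.submatrix id ![a, b, c]).det =
      A 0 a * A 1 b * A 2 c - A 0 a * A 1 c * A 2 b - A 0 b * A 1 a * A 2 c
        + A 0 b * A 1 c * A 2 a + A 0 c * A 1 a * A 2 b - A 0 c * A 1 b * A 2 a := by
  simp [Matrix.det_fin_three]

theorem NsingInt_minor_eq_zero_iff : ∀ a b c : Fin 12, a ≠ b → a ≠ c → b ≠ c →
    (NsingInt 0 a * NsingInt 1 b * NsingInt 2 c - NsingInt 0 a * NsingInt 1 c * NsingInt 2 b
        - NsingInt 0 b * NsingInt 1 a * NsingInt 2 c + NsingInt 0 b * NsingInt 1 c * NsingInt 2 a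
        + NsingInt 0 c * NsingInt 1 a * NsingInt 2 b - NsingInt 0 c * NsingInt 1 b * NsingInt 2 a
        = 0 ↔
      ∃ L ∈ singLinesFinset, (a : ℕ) + 1 ∈ L ∧ (b : ℕ) + 1 ∈ L ∧ (c : ℕ) + 1 ∈ L) := by
  decide +kernel

/-- Three distinct columns of a matrix with three rows are linearly independent iff
the corresponding minor does not vanish. -/
theorem linearIndependent_cols_triple_iff {K n : Type*} [Field K] [DecidableEq n]
    (A : Matrix (Fin 3) n K) {a b c : n} (hab : a ≠ b) (hac : a ≠ c) (hbc : b ≠ c) :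
    LinearIndependent K (fun i : ({a, b, c} : Finset n) => fun r => A r i) ↔
      (A.submatrix id ![a, b, c]).det ≠ 0 := by
  let f : Fin 3 → ({a, b, c} : Finset n) :=
    ![⟨a, by simp⟩, ⟨b, by simp⟩, ⟨c, by simp⟩]
  have hf : Function.Bijective f := by
    constructor
    · intro i j
      fin_cases i <;> fin_cases j <;> simp [f, hab, hac, hbc, hab.symm, hac.symm, hbc.symm]
    · rintro ⟨x, hx⟩
      simp only [Finset.mem_insert, Finset.mem_singleton] at hx
      rcases hx with rfl | rfl | rfl
      exacts [⟨0, rfl⟩, ⟨1, rfl⟩, ⟨2, rfl⟩]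
  have hcols : (fun i : ({a, b, c} : Finset n) => fun r => A r i) ∘ Equiv.ofBijective f hf =
      (A.submatrix id ![a, b, c]).col := by
    ext i r
    fin_cases i <;> rfl
  rw [← linearIndependent_equiv (Equiv.ofBijective f hf), hcols,
    Matrix.linearIndependent_cols_iff_isUnit, Matrix.isUnit_iff_isUnit_det, isUnit_iff_ne_zero]

/-- For every 3-element set `S` of columns of `Nsing`, the
columns indexed by `S` are linearly dependent over `ℚ` iff the corresponding
3-element subset of `{1,…,12}` is contained in some member of `singLines`.
Hence `Q_sing` is realizable over `ℚ`, and in particular over `ℂ`. -/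
theorem Qsing_realizable :
    ∀ S : Finset (Fin 12), S.card = 3 →
      (¬ LinearIndependent ℚ (fun i : S => fun r => Nsing r i) ↔
        ∃ L ∈ singLines, ∀ j ∈ S, ((j : ℕ) + 1) ∈ L) := by
  intro S hS
  obtain ⟨a, b, c, hab, hac, hbc, rfl⟩ := Finset.card_eq_three.mp hS
  rw [linearIndependent_cols_triple_iff Nsing hab hac hbc, not_not, Nsing_eq_map_intCast,
    Matrix.submatrix_map, ← RingHom.mapMatrix_apply, ← RingHom.map_det,
    map_eq_zero_iff _ (Int.castRingHom ℚ).injective_int, det_submatrix_three,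
    NsingInt_minor_eq_zero_iff a b c hab hac hbc]
  simp [singLines, singLinesFinset]
end

section
/- Let A be the 4×8 matrix over the field 𝔽₂ with rows (0,1,0,0,1,1,0,1), (0,0,1,0,1,0,1,1), (0,0,0,1,0,1,1,1), (1,1,1,1,1,1,1,1) (its columns are the eight points of 𝔽₂³ in homogeneous coordinates). Then there is no 4×8 matrix N over ℂ with the property that for every 4-element subset S ⊆ {1,…,8}, the columns of N indexed by S are linearly independent over ℂ if and only if the columns of A indexed by S are linearly independent over 𝔽₂. (That is, the rank-4 matroid of the eight points of 𝔽₂³ is realizable over 𝔽₂ but not over ℂ.) -/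
/-- The `4 × 8` matrix over `𝔽₂` whose columns are the eight points of `𝔽₂³`
in homogeneous coordinates. -/
def binaryCube : Matrix (Fin 4) (Fin 8) (ZMod 2) :=
  !![0, 1, 0, 0, 1, 1, 0, 1;
     0, 0, 1, 0, 1, 0, 1, 1;
     0, 0, 0, 1, 0, 1, 1, 1;
     1, 1, 1, 1, 1, 1, 1, 1]

theorem linearIndependent_cols_finset_iff_det_ne_zero {K : Type*} [Field K] {n : ℕ} {ι : Type*}
    [DecidableEq ι] (A : Matrix (Fin n) ι K) {s : Fin n → ι} (hs : Function.Injective s) :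
    LinearIndependent K (fun i : (Finset.univ.image s : Finset ι) => fun r => A r i) ↔
      (A.submatrix id s).det ≠ 0 := by
  have hb : Function.Bijective (fun j : Fin n =>
      (⟨s j, Finset.mem_image_of_mem s (Finset.mem_univ j)⟩ :
        (Finset.univ.image s : Finset ι))) := by
    refine ⟨fun a b h => hs (congrArg Subtype.val h), ?_⟩
    rintro ⟨x, hx⟩
    obtain ⟨j, -, rfl⟩ := Finset.mem_image.mp hx
    exact ⟨j, rfl⟩
  rw [← linearIndependent_equiv (Equiv.ofBijective _ hb), ← isUnit_iff_ne_zero,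
    ← Matrix.isUnit_iff_isUnit_det, ← Matrix.linearIndependent_cols_iff_isUnit]
  rfl

/-- The `4`-tuples of distinct columns with nonzero minor are the same for `A` and `B`. -/
def SameMinorSupport {K L : Type*} [Field K] [Field L]
    (A : Matrix (Fin 4) (Fin 8) K) (B : Matrix (Fin 4) (Fin 8) L) : Prop :=
  ∀ s : Fin 4 → Fin 8, Function.Injective s →
    ((A.submatrix id s).det ≠ 0 ↔ (B.submatrix id s).det ≠ 0)

theorem SameMinorSupport.mul_left {K L : Type*} [Field K] [Field L]
    {A : Matrix (Fin 4) (Fin 8) K} {B : Matrix (Fin 4) (Fin 8) L} (h : SameMinorSupport A B)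
    {M : Matrix (Fin 4) (Fin 4) K} (hM : M.det ≠ 0) : SameMinorSupport (M * A) B := by
  intro s hs
  have hmul : (M * A).submatrix id s = M * A.submatrix id s := by
    ext i j
    simp [Matrix.mul_apply]
  rw [hmul, Matrix.det_mul, ← h s hs]
  simp [hM]

theorem det_fin_four {R : Type*} [CommRing R] (A : Matrix (Fin 4) (Fin 4) R) :
    A.det =
      A 0 0 * (A 1 1 * (A 2 2 * A 3 3 - A 2 3 * A 3 2)
          - A 1 2 * (A 2 1 * A 3 3 - A 2 3 * A 3 1)
          + A 1 3 * (A 2 1 * A 3 2 - A 2 2 * A 3 1))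
        - A 0 1 * (A 1 0 * (A 2 2 * A 3 3 - A 2 3 * A 3 2)
          - A 1 2 * (A 2 0 * A 3 3 - A 2 3 * A 3 0)
          + A 1 3 * (A 2 0 * A 3 2 - A 2 2 * A 3 0))
        + A 0 2 * (A 1 0 * (A 2 1 * A 3 3 - A 2 3 * A 3 1)
          - A 1 1 * (A 2 0 * A 3 3 - A 2 3 * A 3 0)
          + A 1 3 * (A 2 0 * A 3 1 - A 2 1 * A 3 0))
        - A 0 3 * (A 1 0 * (A 2 1 * A 3 2 - A 2 2 * A 3 1)
          - A 1 1 * (A 2 0 * A 3 2 - A 2 2 * A 3 0)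
          + A 1 2 * (A 2 0 * A 3 1 - A 2 1 * A 3 0)) := by
  simp [Matrix.det_succ_row_zero, Fin.sum_univ_succ, Fin.succAbove]
  ring

theorem not_sameMinorSupport_binaryCube_of_eq_one {K : Type*} [Field K] (h2 : (2 : K) ≠ 0)
    {P : Matrix (Fin 4) (Fin 8) K} (h1 : P.submatrix id ![0, 1, 2, 3] = 1) :
    ¬ SameMinorSupport P binaryCube := by
  intro h
  have e (i j : Fin 4) : P i (![0, 1, 2, 3] j) = (1 : Matrix (Fin 4) (Fin 4) K) i j :=
    congrFun (congrFun h1 i) j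
  have e0 (i : Fin 4) : P i 0 = (1 : Matrix (Fin 4) (Fin 4) K) i 0 := e i 0
  have e1 (i : Fin 4) : P i 1 = (1 : Matrix (Fin 4) (Fin 4) K) i 1 := e i 1
  have e2 (i : Fin 4) : P i 2 = (1 : Matrix (Fin 4) (Fin 4) K) i 2 := e i 2
  have e3 (i : Fin 4) : P i 3 = (1 : Matrix (Fin 4) (Fin 4) K) i 3 := e i 3
  have zero (s : Fin 4 → Fin 8) (hs : Function.Injective s)
      (hd : (binaryCube.submatrix id s).det = 0) : (P.submatrix id s).det = 0 :=
    not_not.mp fun hP => (h s hs).mp hP hd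
  have a3 := zero ![0, 1, 2, 4] (by decide)
    (by rw [det_fin_four]; decide)
  have b2 := zero ![0, 1, 3, 5] (by decide)
    (by rw [det_fin_four]; decide)
  have c1 := zero ![0, 2, 3, 6] (by decide)
    (by rw [det_fin_four]; decide)
  have ad := zero ![0, 3, 4, 7] (by decide)
    (by rw [det_fin_four]; decide)
  have bd := zero ![0, 2, 5, 7] (by decide)
    (by rw [det_fin_four]; decide)
  have cd := zero ![0, 1, 6, 7] (by decide)
    (by rw [det_fin_four]; decide)
  have abc := zero ![0, 4, 5, 6] (by decide)
    (by rw [det_fin_four]; decide)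
  have a1 := (h ![0, 2, 3, 4] (by decide)).mpr
    (by rw [det_fin_four]; decide)
  have b3 := (h ![0, 1, 2, 5] (by decide)).mpr
    (by rw [det_fin_four]; decide)
  have c2 := (h ![0, 1, 3, 6] (by decide)).mpr
    (by rw [det_fin_four]; decide)
  have d1 := (h ![0, 2, 3, 7] (by decide)).mpr
    (by rw [det_fin_four]; decide)
  have d2 := (h ![0, 1, 3, 7] (by decide)).mpr
    (by rw [det_fin_four]; decide)
  have d3 := (h ![0, 1, 2, 7] (by decide)).mpr
    (by rw [det_fin_four]; decide)
  simp [det_fin_four, e0, e1, e2, e3] at a3 b2 c1 ad bd cd abc a1 b3 c2 d1 d2 d3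
  have : 2 * (P 1 4 * P 3 5 * P 2 6 * P 1 7 * P 2 7 * P 3 7) = 0 := by
    rw [a3, b2, c1] at abc
    linear_combination (P 1 7 * P 3 5 * P 2 6 * P 3 7) * ad + (P 1 7 * P 2 4 * P 2 6 * P 3 7) * bd
      + (P 1 7 * P 2 4 * P 1 5 * P 3 7) * cd - (P 1 7 * P 2 7 * P 3 7) * abc
  simp [h2, a1, b3, c2, d1, d2, d3] at this

/-- There is no `4 × 8` complex matrix whose 4-element column
sets have exactly the same pattern of linear independence as those of
`binaryCube`: the rank-4 matroid of the eight points of `𝔽₂³` is not realizable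
over `ℂ`. -/
theorem binaryCube_not_complex_realizable :
    ¬ ∃ N : Matrix (Fin 4) (Fin 8) ℂ,
      ∀ S : Finset (Fin 8), S.card = 4 →
        (LinearIndependent ℂ (fun i : S => fun r => N r i) ↔
          LinearIndependent (ZMod 2) (fun i : S => fun r => binaryCube r i)) := by
  rintro ⟨N, hN⟩
  have h : SameMinorSupport N binaryCube := fun s hs => by
    rw [← linearIndependent_cols_finset_iff_det_ne_zero N hs,
      ← linearIndependent_cols_finset_iff_det_ne_zero binaryCube hs]
    exact hN _ (by rw [Finset.card_image_of_injective _ hs, Finset.card_univ, Fintype.card_fin])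
  have hM : (N.submatrix id ![0, 1, 2, 3]).det ≠ 0 := (h _ (by decide)).mpr
    (by rw [det_fin_four]; decide)
  refine not_sameMinorSupport_binaryCube_of_eq_one two_ne_zero ?_
    (h.mul_left (Matrix.isUnit_nonsing_inv_det _ hM.isUnit).ne_zero)
  rw [← Matrix.nonsing_inv_mul _ hM.isUnit]
  ext i j
  simp [Matrix.mul_apply]
end
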